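/- arXiv:1505.03428 — 5 statements merged into one kernel-verified Lean document; each statement's English description precedes it below -/
import Mathlib

section
/- Hausdorff distance of affine subspaces from one-sided closeness (Lemma 4.2): Let V, W be two k-dimensional affine subspaces of ℝⁿ and suppose V ∩ B_{1/2}(0) ≠ ∅. There exists a constant c = c(k,n) such that for every δ > 0, if V ∩ B_1(0) ⊆ B_δ(W ∩ B_1(0)), then W ∩ B_1(0) ⊆ B_{cδ}(V ∩ B_1(0)); in particular d_H(V ∩ B_1(0), W ∩ B_1(0)) ≤ cδ. -/
open MeasureTheory Metric
open scoped ENNReal NNReal RealInnerProductSpace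

noncomputable section

/-- `ω_k`: the Lebesgue measure of the unit ball in `ℝ^k`. -/
def omegaK (k : ℕ) : ℝ :=
  (volume (ball (0 : EuclideanSpace ℝ (Fin k)) 1)).toReal

/-- `ε_n = (1000 n)^(-7 n²)`. -/
def epsN (n : ℕ) : ℝ := (1000 * (n : ℝ)) ^ (-(7 * (n : ℤ) ^ 2))

/-- `γ_k = ω_k 40^(-k)`. -/
def gammaK (k : ℕ) : ℝ := omegaK k * (40 : ℝ) ^ (-(k : ℤ))

/-- `L` is a (nonempty) `k`-dimensional affine subspace of `ℝⁿ`. -/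
def IsAffineSubspaceDim (n k : ℕ) (L : AffineSubspace ℝ (EuclideanSpace ℝ (Fin n))) : Prop :=
  (L : Set (EuclideanSpace ℝ (Fin n))).Nonempty ∧ Module.finrank ℝ L.direction = k

/-- The infimum over all `k`-dimensional affine subspaces `L ⊆ ℝⁿ` of
`∫_{B_r(x)} dist(y,L)² dμ(y)`. -/
def dispInf (n k : ℕ) (μ : Measure (EuclideanSpace ℝ (Fin n)))
    (x : EuclideanSpace ℝ (Fin n)) (r : ℝ) : ℝ :=
  sInf { t : ℝ | ∃ L : AffineSubspace ℝ (EuclideanSpace ℝ (Fin n)),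
    IsAffineSubspaceDim n k L ∧
    t = ∫ y in ball x r, infDist y (L : Set (EuclideanSpace ℝ (Fin n))) ^ 2 ∂μ }

/-- The `k`-dimensional displacement `D^k_μ(x,r)`. -/
def disp (n k : ℕ) (μ : Measure (EuclideanSpace ℝ (Fin n)))
    (x : EuclideanSpace ℝ (Fin n)) (r : ℝ) : ℝ :=
  if ENNReal.ofReal (epsN n * r ^ k) ≤ μ (ball x r) then
    r ^ (-((k : ℤ) + 2)) * dispInf n k μ x r
  else 0

/-- `D^k_S(x,r)`: the displacement of the `k`-dimensional Hausdorff measure restricted to `S`. -/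
def dispSet (n k : ℕ) (S : Set (EuclideanSpace ℝ (Fin n)))
    (x : EuclideanSpace ℝ (Fin n)) (r : ℝ) : ℝ :=
  disp n k (μH[(k : ℝ)].restrict S) x r

/-- A set `T ⊆ ℝⁿ` is `k`-rectifiable: there are countably many Lipschitz maps
`f_i : ℝ^k → ℝⁿ` with `λ^k (T \ ⋃ f_i(ℝ^k)) = 0`. -/
def KRectifiable (n k : ℕ) (T : Set (EuclideanSpace ℝ (Fin n))) : Prop :=
  ∃ f : ℕ → (EuclideanSpace ℝ (Fin k) → EuclideanSpace ℝ (Fin n)),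
    (∀ i, ∃ C : NNReal, LipschitzWith C (f i)) ∧
    μH[(k : ℝ)] (T \ ⋃ i, Set.range (f i)) = 0

section OneSidedCloseness

variable {E : Type*} [NormedAddCommGroup E] [InnerProductSpace ℝ E]

/-- If every vector of `U` is relatively `ε`-close to `K`, with `ε < 1` and `U`, `K` of the same
finite dimension, then every vector of `K` is the orthogonal projection of a vector of `U`
relatively `ε`-close to it. -/
theorem Submodule.exists_mem_norm_sub_le_of_finrank_eq (U K : Submodule ℝ E)
    [FiniteDimensional ℝ U] [FiniteDimensional ℝ K]
    (hUK : Module.finrank ℝ U = Module.finrank ℝ K) {ε : ℝ} (hε : ε < 1)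
    (h : ∀ u ∈ U, ∃ w ∈ K, ‖u - w‖ ≤ ε * ‖u‖) {w : E} (hw : w ∈ K) :
    ∃ u ∈ U, ‖u - w‖ ≤ ε * ‖u‖ := by
  have hproj : ∀ u ∈ U, ‖u - K.starProjection u‖ ≤ ε * ‖u‖ := by
    intro u hu
    obtain ⟨v, hv, huv⟩ := h u hu
    rw [K.starProjection_minimal]
    exact (ciInf_le ⟨0, by rintro _ ⟨x, rfl⟩; positivity⟩ (⟨v, hv⟩ : K)).trans huv
  let f : U →ₗ[ℝ] K := (K.orthogonalProjectionOnto : E →ₗ[ℝ] K) ∘ₗ U.subtype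
  have hf : Function.Injective f := by
    rw [injective_iff_map_eq_zero]
    intro u hu
    have hle := hproj u u.2
    have hzero : K.starProjection (u : E) = 0 := by
      rw [Submodule.starProjection_apply]
      exact congrArg Subtype.val hu
    rw [hzero, sub_zero] at hle
    have : ‖(u : E)‖ = 0 := by nlinarith [norm_nonneg (u : E)]
    exact Subtype.ext (norm_eq_zero.mp this)
  obtain ⟨u, hu⟩ :=
    (LinearMap.injective_iff_surjective_of_finrank_eq_finrank hUK).mp hf ⟨w, hw⟩
  refine ⟨u, u.2, ?_⟩
  have hval : K.starProjection (u : E) = w := by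
    rw [Submodule.starProjection_apply]
    exact congrArg Subtype.val hu
  rw [← hval]
  exact hproj u u.2

/-- If the points of `V` at distance at most `r` from `p ∈ V` are `δ`-close to `W`, then every
vector of the direction of `V` is relatively `2δ/r`-close to the direction of `W`. -/
theorem AffineSubspace.exists_mem_direction_norm_sub_le (V W : AffineSubspace ℝ E) {p : E}
    (hp : p ∈ V) {r δ : ℝ} (hr : 0 < r)
    (h : ∀ x ∈ V, dist x p ≤ r → ∃ y ∈ W, dist x y ≤ δ) {u : E} (hu : u ∈ V.direction) :
    ∃ w ∈ W.direction, ‖u - w‖ ≤ 2 * δ / r * ‖u‖ := by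
  rcases eq_or_ne u 0 with rfl | hu0
  · exact ⟨0, W.direction.zero_mem, by simp⟩
  have hnorm : 0 < ‖u‖ := norm_pos_iff.mpr hu0
  set t : ℝ := r / ‖u‖ with ht
  have htpos : 0 < t := by positivity
  have htu : t * ‖u‖ = r := by rw [ht]; field_simp
  have hmem : t • u + p ∈ V := V.vadd_mem_of_mem_direction (V.direction.smul_mem t hu) hp
  obtain ⟨q, hq, hpq⟩ := h p hp (by simpa using hr.le)
  obtain ⟨q', hq', hpq'⟩ := h _ hmem (by
    rw [dist_eq_norm, add_sub_cancel_right, norm_smul, Real.norm_of_nonneg htpos.le, htu])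
  refine ⟨t⁻¹ • (q' - q), W.direction.smul_mem _ (W.vsub_mem_direction hq' hq), ?_⟩
  have hclose : ‖t • u - (q' - q)‖ ≤ 2 * δ := by
    rw [dist_eq_norm] at hpq hpq'
    calc ‖t • u - (q' - q)‖ = ‖(t • u + p - q') - (p - q)‖ := by congr 1; abel
      _ ≤ ‖t • u + p - q'‖ + ‖p - q‖ := norm_sub_le _ _
      _ ≤ 2 * δ := by linarith
  calc ‖u - t⁻¹ • (q' - q)‖ = ‖t⁻¹ • (t • u - (q' - q))‖ := by
        rw [smul_sub t⁻¹ (t • u), inv_smul_smul₀ htpos.ne']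
    _ = t⁻¹ * ‖t • u - (q' - q)‖ := by
        rw [norm_smul, Real.norm_of_nonneg (inv_nonneg.mpr htpos.le)]
    _ ≤ t⁻¹ * (2 * δ) := by gcongr
    _ = 2 * δ / r * ‖u‖ := by rw [ht, inv_div]; ring

/-- A point `z` of `V` lying slightly outside the unit ball can be moved into the unit ball
within `V`, towards a point `p` of `V` in the ball of radius `1/2`. -/
theorem AffineSubspace.exists_mem_ball_dist_le (V : AffineSubspace ℝ E) {p z : E}
    (hp : p ∈ V) (hz : z ∈ V) (hp' : ‖p‖ < 1 / 2) {η : ℝ} (hη : 0 < η) (hz' : ‖z‖ ≤ 1 + η) :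
    ∃ x ∈ (V : Set E) ∩ ball 0 1, dist z x ≤ 2 * η * dist z p := by
  set s : ℝ := (1 + 2 * η)⁻¹ with hs
  have hspos : 0 < s := by positivity
  have hsη : s * (1 + 2 * η) = 1 := inv_mul_cancel₀ (by positivity)
  have hs1 : s < 1 := by nlinarith
  refine ⟨AffineMap.lineMap p z s, ⟨AffineMap.lineMap_mem s hp hz, ?_⟩, ?_⟩
  · rw [mem_ball_zero_iff, AffineMap.lineMap_apply_module]
    calc ‖(1 - s) • p + s • z‖ ≤ ‖(1 - s) • p‖ + ‖s • z‖ := norm_add_le _ _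
      _ = (1 - s) * ‖p‖ + s * ‖z‖ := by
        rw [norm_smul, norm_smul, Real.norm_of_nonneg (by linarith), Real.norm_of_nonneg hspos.le]
      _ < (1 - s) * (1 / 2) + s * (1 + η) := by
        nlinarith
      _ = 1 := by linarith
  · rw [dist_comm z, dist_lineMap_right, Real.norm_of_nonneg (by linarith), dist_comm p]
    gcongr
    nlinarith

/-- One-sided closeness in the unit ball of affine subspaces of equal dimension is, up to a
constant, symmetric. -/
theorem AffineSubspace.inter_ball_subset_thickening_of_finrank_eq [FiniteDimensional ℝ E]
    (V W : AffineSubspace ℝ E)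
    (hVW : Module.finrank ℝ V.direction = Module.finrank ℝ W.direction)
    (hV : ((V : Set E) ∩ ball 0 (1 / 2)).Nonempty) {δ : ℝ} (hδ : 0 < δ)
    (h : (V : Set E) ∩ ball 0 1 ⊆ thickening δ ((W : Set E) ∩ ball 0 1)) :
    (W : Set E) ∩ ball 0 1 ⊆ thickening (300 * δ) ((V : Set E) ∩ ball 0 1) := by
  obtain ⟨p, hpV, hp⟩ := hV
  rw [mem_ball_zero_iff] at hp
  rintro y ⟨hyW, hy⟩
  rw [mem_ball_zero_iff] at hy
  have hpball : p ∈ (V : Set E) ∩ ball 0 1 := ⟨hpV, by rw [mem_ball_zero_iff]; linarith⟩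
  rw [mem_thickening_iff]
  rcases le_or_gt δ (1 / 16) with hsmall | hlarge
  · have hclose : ∀ x ∈ V, dist x p ≤ 1 / 4 → ∃ y ∈ W, dist x y ≤ δ := by
      intro x hx hxp
      have hxball : x ∈ ball (0 : E) 1 := by
        rw [mem_ball_zero_iff]
        rw [dist_eq_norm] at hxp
        linarith [norm_le_norm_add_norm_sub p x, norm_sub_rev p x]
      obtain ⟨q, hq, hxq⟩ := mem_thickening_iff.mp (h ⟨hx, hxball⟩)
      exact ⟨q, hq.1, hxq.le⟩
    obtain ⟨q, ⟨hqW, hq⟩, hpq⟩ := mem_thickening_iff.mp (h hpball)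
    rw [mem_ball_zero_iff] at hq
    rw [dist_eq_norm] at hpq
    obtain ⟨u, hu, huw⟩ := V.direction.exists_mem_norm_sub_le_of_finrank_eq W.direction hVW
      (by linarith : 2 * δ / (1 / 4) < 1)
      (fun u hu => V.exists_mem_direction_norm_sub_le W hpV (by norm_num) hclose hu)
      (W.vsub_mem_direction hyW hqW)
    rw [vsub_eq_sub] at huw
    have hyq : ‖y - q‖ ≤ 2 := by linarith [norm_sub_le y q]
    have hu4 : ‖u‖ ≤ 4 := by
      nlinarith [norm_nonneg u, norm_le_norm_add_norm_sub (y - q) u, norm_sub_rev u (y - q)]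
    have huw' : ‖u - (y - q)‖ ≤ 32 * δ := by nlinarith
    have hzy : ‖u + p - y‖ < 33 * δ := by
      calc ‖u + p - y‖ = ‖(u - (y - q)) + (p - q)‖ := by congr 1; abel
        _ ≤ ‖u - (y - q)‖ + ‖p - q‖ := norm_add_le _ _
        _ < 33 * δ := by linarith
    have hzV : u + p ∈ V := V.vadd_mem_of_mem_direction hu hpV
    obtain ⟨x, hx, hzx⟩ := V.exists_mem_ball_dist_le hpV hzV hp (by positivity : 0 < 33 * δ)
      (by linarith [norm_le_norm_add_norm_sub y (u + p), norm_sub_rev y (u + p)])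
    refine ⟨x, hx, ?_⟩
    have hzp : dist (u + p) p = ‖u‖ := by rw [dist_eq_norm, add_sub_cancel_right]
    rw [hzp] at hzx
    have hyz : dist y (u + p) < 33 * δ := by rwa [dist_comm, dist_eq_norm]
    nlinarith [dist_triangle y (u + p) x]
  · refine ⟨p, hpball, ?_⟩
    rw [dist_eq_norm]
    linarith [norm_sub_le y p]

end OneSidedCloseness

/-- **Hausdorff distance of affine subspaces from one-sided closeness** (Lemma 4.2).
Let `V, W` be `k`-dimensional affine subspaces of `ℝⁿ` with `V ∩ B_{1/2}(0) ≠ ∅`. There is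
`c = c(k,n)` such that for every `δ > 0`, if `V ∩ B_1(0) ⊆ B_δ(W ∩ B_1(0))` then
`W ∩ B_1(0) ⊆ B_{cδ}(V ∩ B_1(0))`; in particular
`d_H(V ∩ B_1(0), W ∩ B_1(0)) ≤ cδ`. -/
theorem hausdorffDist_affine_subspaces_of_one_sided (n k : ℕ) (hk : k ≤ n) :
    ∃ c : ℝ, 0 < c ∧
      ∀ V W : AffineSubspace ℝ (EuclideanSpace ℝ (Fin n)),
        IsAffineSubspaceDim n k V → IsAffineSubspaceDim n k W →
        ((V : Set (EuclideanSpace ℝ (Fin n))) ∩ ball 0 (1 / 2)).Nonempty →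
        ∀ δ : ℝ, 0 < δ →
        (V : Set (EuclideanSpace ℝ (Fin n))) ∩ ball 0 1 ⊆
          thickening δ ((W : Set (EuclideanSpace ℝ (Fin n))) ∩ ball 0 1) →
        ((W : Set (EuclideanSpace ℝ (Fin n))) ∩ ball 0 1 ⊆
          thickening (c * δ) ((V : Set (EuclideanSpace ℝ (Fin n))) ∩ ball 0 1)) ∧
        hausdorffDist ((V : Set (EuclideanSpace ℝ (Fin n))) ∩ ball 0 1)
            ((W : Set (EuclideanSpace ℝ (Fin n))) ∩ ball 0 1) ≤ c * δ := by
  refine ⟨300, by norm_num, fun V W hV hW hne δ hδ h => ?_⟩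
  have hWV := V.inter_ball_subset_thickening_of_finrank_eq W (hV.2.trans hW.2.symm) hne hδ h
  refine ⟨hWV, hausdorffDist_le_of_mem_dist (by positivity) (fun x hx => ?_) (fun y hy => ?_)⟩
  · obtain ⟨y, hy, hxy⟩ := mem_thickening_iff.mp (h hx)
    exact ⟨y, hy, by linarith⟩
  · obtain ⟨x, hx, hyx⟩ := mem_thickening_iff.mp (hWV hy)
    exact ⟨x, hx, hyx.le⟩
end
end

section
/- Grassmannian distance and orthogonal complements (Lemma 4.3): Let V, W be closed linear subspaces of a real Hilbert space H. Then d_G(V,W) = d_G(V^⊥, W^⊥), where V^⊥ denotes the orthogonal complement of V. -/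
open MeasureTheory Metric
open scoped ENNReal NNReal RealInnerProductSpace

noncomputable section

/-- The Grassmannian distance between two linear subspaces of an inner product space:
the Hausdorff distance between their intersections with the closed unit ball. -/
def grassDist {H : Type*} [NormedAddCommGroup H] [InnerProductSpace ℝ H]
    (V W : Submodule ℝ H) : ℝ :=
  hausdorffDist ((V : Set H) ∩ closedBall 0 1) ((W : Set H) ∩ closedBall 0 1)

theorem hausdorffEDist_inter_closedBall_ne_top {H : Type*} [NormedAddCommGroup H]
    [InnerProductSpace ℝ H] (V W : Submodule ℝ H) :
    hausdorffEDist ((V : Set H) ∩ closedBall 0 1) ((W : Set H) ∩ closedBall 0 1) ≠ ⊤ :=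
  hausdorffEDist_ne_top_of_nonempty_of_bounded
    ⟨0, V.zero_mem, mem_closedBall_self zero_le_one⟩
    ⟨0, W.zero_mem, mem_closedBall_self zero_le_one⟩
    (isBounded_closedBall.subset Set.inter_subset_right)
    (isBounded_closedBall.subset Set.inter_subset_right)

theorem norm_starProjection_le_grassDist {H : Type*} [NormedAddCommGroup H]
    [InnerProductSpace ℝ H] (V W : Submodule ℝ H) [V.HasOrthogonalProjection]
    {x : H} (hx : x ∈ Wᗮ) (hx1 : ‖x‖ ≤ 1) : ‖V.starProjection x‖ ≤ grassDist V W := by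
  set u := V.starProjection x with hu
  have huV : u ∈ V := V.starProjection_apply_mem x
  rcases eq_or_ne u 0 with h0 | h0
  · rw [h0, norm_zero]
    exact hausdorffDist_nonneg
  have hpos : 0 < ‖u‖ := norm_pos_iff.2 h0
  have hxu : ⟪x, u⟫ = ‖u‖ * ‖u‖ := by
    have h : ⟪x - u, u⟫ = 0 := V.starProjection_inner_eq_zero x u huV
    rw [inner_sub_left, real_inner_self_eq_norm_mul_norm] at h
    linarith
  refine le_of_forall_gt fun r hr => ?_
  have hv : ‖u‖⁻¹ • u ∈ (V : Set H) ∩ closedBall 0 1 := by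
    refine ⟨V.smul_mem _ huV, ?_⟩
    rw [mem_closedBall_zero_iff, norm_smul, norm_inv, norm_norm, inv_mul_cancel₀ hpos.ne']
  obtain ⟨w, hw, hd⟩ := exists_dist_lt_of_hausdorffDist_lt hv hr
    (hausdorffEDist_inter_closedBall_ne_top V W)
  have hxw : ⟪x, w⟫ = 0 := Submodule.inner_left_of_mem_orthogonal hw.1 hx
  calc ‖u‖ = ⟪x, ‖u‖⁻¹ • u - w⟫ := by
        rw [inner_sub_right, hxw, inner_smul_right, hxu]
        field_simp
        ring
    _ ≤ ‖x‖ * ‖‖u‖⁻¹ • u - w‖ := real_inner_le_norm _ _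
    _ ≤ 1 * ‖‖u‖⁻¹ • u - w‖ := by gcongr
    _ < r := by rwa [one_mul, ← dist_eq_norm]

theorem exists_mem_orthogonal_dist_le_grassDist {H : Type*} [NormedAddCommGroup H]
    [InnerProductSpace ℝ H] (V W : Submodule ℝ H) [V.HasOrthogonalProjection]
    {x : H} (hx : x ∈ (Wᗮ : Set H) ∩ closedBall 0 1) :
    ∃ y ∈ (Vᗮ : Set H) ∩ closedBall 0 1, dist x y ≤ grassDist V W := by
  have hx1 : ‖x‖ ≤ 1 := mem_closedBall_zero_iff.1 hx.2
  refine ⟨Vᗮ.starProjection x, ⟨Vᗮ.starProjection_apply_mem x, ?_⟩, ?_⟩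
  · exact mem_closedBall_zero_iff.2 ((Vᗮ.norm_starProjection_apply_le x).trans hx1)
  · rw [dist_eq_norm, V.starProjection_orthogonal_val, sub_sub_cancel]
    exact norm_starProjection_le_grassDist V W hx.1 hx1

theorem grassDist_orthogonal_le {H : Type*} [NormedAddCommGroup H] [InnerProductSpace ℝ H]
    (V W : Submodule ℝ H) [V.HasOrthogonalProjection] [W.HasOrthogonalProjection] :
    grassDist Vᗮ Wᗮ ≤ grassDist V W := by
  refine hausdorffDist_le_of_mem_dist hausdorffDist_nonneg (fun x hx => ?_) fun x hx =>
    exists_mem_orthogonal_dist_le_grassDist V W hx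
  rw [grassDist, hausdorffDist_comm]
  exact exists_mem_orthogonal_dist_le_grassDist W V hx

/-- **Grassmannian distance and orthogonal complements** (Lemma 4.3).
Let `V, W` be closed linear subspaces of a real Hilbert space `H`. Then
`d_G(V,W) = d_G(V^⊥, W^⊥)`. -/
theorem grassDist_orthogonal_complements
    (H : Type*) [NormedAddCommGroup H] [InnerProductSpace ℝ H] [CompleteSpace H]
    (V W : Submodule ℝ H) (hV : IsClosed (V : Set H)) (hW : IsClosed (W : Set H)) :
    grassDist V W = grassDist Vᗮ Wᗮ := by
  have := hV.completeSpace_coe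
  have := hW.completeSpace_coe
  refine le_antisymm ?_ (grassDist_orthogonal_le V W)
  simpa only [Submodule.orthogonal_orthogonal] using grassDist_orthogonal_le Vᗮ Wᗮ
end
end

section
/- Quantitative affine coordinates from effectively spanning points (Lemma 4.6): Let α > 0 and let p_0, …, p_k ∈ ℝⁿ α-effectively span the k-dimensional affine subspace V = p_0 + span{p_1 − p_0, …, p_k − p_0}. Then there exists a constant c = c(n,α) such that for every x ∈ V there is a unique tuple (α_1, …, α_k) ∈ ℝ^k with x = p_0 + Σ_{i=1}^k α_i (p_i − p_0), and moreover |α_i| ≤ c ‖x − p_0‖ for every i. -/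
open MeasureTheory Metric
open scoped ENNReal NNReal RealInnerProductSpace

noncomputable section

/-- Points `p_0, …, p_k` `α`-effectively span a `k`-dimensional affine subspace:
for each `i = 1, …, k`, `‖p_i − p_0‖ ≤ α⁻¹` and
`p_i ∉ B_α(p_0 + span{p_1 − p_0, …, p_{i−1} − p_0})`. -/
def EffectivelySpans (n k : ℕ) (α : ℝ) (p : Fin (k + 1) → EuclideanSpace ℝ (Fin n)) : Prop :=
  ∀ i : Fin k, ‖p i.succ - p 0‖ ≤ α⁻¹ ∧
    p i.succ ∉ thickening α
      ((fun v => p 0 + v) ''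
        ((Submodule.span ℝ {w | ∃ j : Fin k, (j : ℕ) < (i : ℕ) ∧ w = p j.succ - p 0} :
          Submodule ℝ (EuclideanSpace ℝ (Fin n))) : Set (EuclideanSpace ℝ (Fin n))))

/-- If each vector of a family stays at distance at least `α` from the span of the preceding ones,
and all have norm at most `M`, then the coefficients of a linear combination are controlled by its
norm. -/
theorem abs_coeff_le_of_le_norm_sub_span {E : Type*} [NormedAddCommGroup E] [NormedSpace ℝ E]
    {α M : ℝ} (hα : 0 < α) (hM : 0 ≤ M) (m : ℕ) (v : Fin m → E) (hv : ∀ i, ‖v i‖ ≤ M)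
    (hd : ∀ i, ∀ w ∈ Submodule.span ℝ (v '' Set.Iio i), α ≤ ‖v i - w‖) (a : Fin m → ℝ)
    (i : Fin m) : |a i| ≤ α⁻¹ * (1 + M * α⁻¹) ^ m * ‖∑ j, a j • v j‖ := by
  induction m with
  | zero => exact i.elim0
  | succ m ih =>
    have hK : 1 ≤ 1 + M * α⁻¹ := le_add_of_nonneg_right (by positivity)
    set y := ∑ j : Fin m, a j.castSucc • v j.castSucc
    have hsum : ∑ j, a j • v j = y + a (Fin.last m) • v (Fin.last m) := Fin.sum_univ_castSucc _
    have hymem : y ∈ Submodule.span ℝ (v '' Set.Iio (Fin.last m)) :=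
      Submodule.sum_mem _ fun j _ => Submodule.smul_mem _ _
        (Submodule.subset_span ⟨j.castSucc, Fin.castSucc_lt_last j, rfl⟩)
    rw [hsum]
    set x := y + a (Fin.last m) • v (Fin.last m) with hx
    have hlast : |a (Fin.last m)| ≤ α⁻¹ * ‖x‖ := by
      rw [le_inv_mul_iff₀ hα]
      rcases eq_or_ne (a (Fin.last m)) 0 with h0 | h0
      · simp [h0]
      · have h := hd (Fin.last m) (-((a (Fin.last m))⁻¹ • y))
          (Submodule.neg_mem _ (Submodule.smul_mem _ _ hymem))
        have hxe : x = a (Fin.last m) •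
            (v (Fin.last m) - -((a (Fin.last m))⁻¹ • y)) := by
          rw [sub_neg_eq_add, smul_add, smul_inv_smul₀ h0, add_comm]
        rw [hxe, norm_smul, Real.norm_eq_abs, mul_comm]
        gcongr
    have hynorm : ‖y‖ ≤ (1 + M * α⁻¹) * ‖x‖ := by
      have hye : y = x - a (Fin.last m) • v (Fin.last m) := by simp [hx]
      calc ‖y‖ ≤ ‖x‖ + |a (Fin.last m)| * ‖v (Fin.last m)‖ := by
            conv_lhs => rw [hye]
            simpa [norm_smul] using norm_sub_le x (a (Fin.last m) • v (Fin.last m))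
        _ ≤ ‖x‖ + (α⁻¹ * ‖x‖) * M := by
            gcongr
            exact hv _
        _ = (1 + M * α⁻¹) * ‖x‖ := by ring
    induction i using Fin.lastCases with
    | last =>
      refine hlast.trans ?_
      gcongr
      exact le_mul_of_one_le_right (by positivity) (one_le_pow₀ hK)
    | cast i =>
      have h := ih (fun j => v j.castSucc) (fun j => hv _) (fun j w hw => hd _ w <| by
        refine Submodule.span_mono ?_ hw
        rintro _ ⟨l, hl, rfl⟩
        exact ⟨l.castSucc, Fin.castSucc_lt_castSucc_iff.2 hl, rfl⟩)
        (fun j => a j.castSucc) i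
      calc |a i.castSucc| ≤ α⁻¹ * (1 + M * α⁻¹) ^ m * ‖y‖ := h
        _ ≤ α⁻¹ * (1 + M * α⁻¹) ^ m * ((1 + M * α⁻¹) * ‖x‖) := by gcongr
        _ = α⁻¹ * (1 + M * α⁻¹) ^ (m + 1) * ‖x‖ := by ring

theorem EffectivelySpans.le_norm_sub {n k : ℕ} {α : ℝ}
    {p : Fin (k + 1) → EuclideanSpace ℝ (Fin n)} (hp : EffectivelySpans n k α p) (i : Fin k)
    (w : EuclideanSpace ℝ (Fin n))
    (hw : w ∈ Submodule.span ℝ ((fun j : Fin k => p j.succ - p 0) '' Set.Iio i)) :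
    α ≤ ‖p i.succ - p 0 - w‖ := by
  by_contra! h
  refine (hp i).2 (mem_thickening_iff.2 ⟨p 0 + w, ⟨w, ?_, rfl⟩, ?_⟩)
  · refine Submodule.span_mono ?_ hw
    rintro _ ⟨j, hj, rfl⟩
    exact ⟨j, hj, rfl⟩
  · rwa [dist_eq_norm, ← sub_sub]

theorem EffectivelySpans.abs_coeff_le {n k : ℕ} {α : ℝ} (hα : 0 < α)
    {p : Fin (k + 1) → EuclideanSpace ℝ (Fin n)} (hp : EffectivelySpans n k α p)
    (a : Fin k → ℝ) (i : Fin k) :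
    |a i| ≤ α⁻¹ * (1 + α⁻¹ * α⁻¹) ^ k * ‖∑ j, a j • (p j.succ - p 0)‖ :=
  abs_coeff_le_of_le_norm_sub_span hα (by positivity) k (fun j => p j.succ - p 0)
    (fun j => (hp j).1) hp.le_norm_sub a i

/-- **Quantitative affine coordinates from effectively spanning points** (Lemma 4.6).
If `p_0, …, p_k` `α`-effectively span
`V = p_0 + span{p_1 − p_0, …, p_k − p_0}`, then there is `c = c(n,α)` such that every
`x ∈ V` has a unique representation `x = p_0 + Σ α_i (p_i − p_0)`, and the coefficients
satisfy `|α_i| ≤ c ‖x − p_0‖`. -/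
theorem effectively_spans_coordinates (n k : ℕ) (hk : k ≤ n) (α : ℝ) (hα : 0 < α) :
    ∃ c : ℝ, 0 < c ∧
      ∀ p : Fin (k + 1) → EuclideanSpace ℝ (Fin n), EffectivelySpans n k α p →
      ∀ x ∈ (fun v => p 0 + v) ''
          ((Submodule.span ℝ (Set.range fun i : Fin k => p i.succ - p 0) :
            Submodule ℝ (EuclideanSpace ℝ (Fin n))) : Set (EuclideanSpace ℝ (Fin n))),
        (∃! a : Fin k → ℝ, x = p 0 + ∑ i, a i • (p i.succ - p 0)) ∧
        ∀ a : Fin k → ℝ, x = p 0 + ∑ i, a i • (p i.succ - p 0) →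
          ∀ i, |a i| ≤ c * ‖x - p 0‖ := by
  refine ⟨α⁻¹ * (1 + α⁻¹ * α⁻¹) ^ k, by positivity, ?_⟩
  rintro p hp _ ⟨v, hv, rfl⟩
  obtain ⟨a, rfl⟩ := (Submodule.mem_span_range_iff_exists_fun ℝ).1 hv
  refine ⟨⟨a, rfl, fun b hb => ?_⟩, fun b hb i => ?_⟩
  · have hab : ∑ j, (b - a) j • (p j.succ - p 0) = 0 := by
      simp only [Pi.sub_apply, sub_smul _ _ (_ - _), Finset.sum_sub_distrib]
      exact sub_eq_zero.2 (add_left_cancel hb).symm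
    funext i
    have h := hp.abs_coeff_le hα (b - a) i
    rw [hab, norm_zero, mul_zero] at h
    exact sub_eq_zero.1 (abs_nonpos_iff.1 h)
  · rw [hb, add_sub_cancel_left]
    exact hp.abs_coeff_le hα b i
end
end

section
/- Distance between L²-best planes at nearby scales (Lemma 4.8): Let 0 ≤ k ≤ n, M > 0, and 0 < ρ ≤ ρ_0(n,M). Let μ be a positive Radon measure on ℝⁿ supported in B̄_1(0) with μ(B_1(0)) ≥ γ_k and μ(B_{ρ²}(y)) ≤ M ρ^{2k} for every y ∈ B_1(0). Let B_ρ(x) ⊆ B_1(0) be a ball with μ(B_ρ(x)) ≥ γ_k ρ^k. Let V(0,1) be a k-dimensional affine subspace minimizing V ↦ ∫_{B_1(0)} dist(y,V)² dμ(y) over all k-dimensional affine subspaces of ℝⁿ, and let V(x,ρ) be a k-dimensional affine subspace minimizing V ↦ ∫_{B_ρ(x)} dist(y,V)² dμ(y). Set A := V(0,1) ∩ B_ρ(x) and B := V(x,ρ) ∩ B_ρ(x), and suppose dist(x,A) < ρ/2. Then d_H(A,B)² ≤ c(n,ρ,M) (D^k_μ(x,ρ) + D^k_μ(0,1)). -/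
open MeasureTheory Metric
open scoped ENNReal NNReal RealInnerProductSpace

noncomputable section

section Geometry

variable {E : Type*} [NormedAddCommGroup E] [InnerProductSpace ℝ E] [FiniteDimensional ℝ E]

theorem norm_sub_starProjection_le (D : Submodule ℝ E) (v : E) :
    ‖v - D.starProjection v‖ ≤ ‖v‖ := by
  rw [← Submodule.starProjection_orthogonal_val]
  exact Submodule.norm_starProjection_apply_le _ _

theorem infDist_eq_norm_sub_starProjection (V : AffineSubspace ℝ E) {q : E} (hq : q ∈ V) (y : E) :
    infDist y (V : Set E) = ‖(y - q) - V.direction.starProjection (y - q)‖ := by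
  apply le_antisymm
  · have hmem : V.direction.starProjection (y - q) +ᵥ q ∈ V :=
      AffineSubspace.vadd_mem_of_mem_direction (Submodule.starProjection_apply_mem _ _) hq
    refine (infDist_le_dist_of_mem (s := (V : Set E)) hmem).trans_eq ?_
    rw [dist_eq_norm, vadd_eq_add]
    congr 1
    abel
  · refine (le_infDist ⟨q, hq⟩).2 fun v hv => ?_
    have hvq : v - q ∈ V.direction := AffineSubspace.vsub_mem_direction hv hq
    have h1 := Submodule.starProjection_eq_self_iff.2 hvq
    have h2 : (y - q) - V.direction.starProjection (y - q)
        = (y - v) - V.direction.starProjection (y - v) := by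
      have h3 : y - v = (y - q) - (v - q) := by abel
      rw [h3, map_sub _ (y - q), h1]
      abel
    rw [h2, dist_eq_norm]
    exact norm_sub_starProjection_le _ _

/-- Comparing an affine subspace `V` with another one `V'`: the distance to `V'` at a point of `V`
extends to an affine function that is controlled by the two distance functions. -/
theorem exists_affine_le_infDist_add_infDist (V V' : AffineSubspace ℝ E) {q' z : E}
    (hq' : q' ∈ V') (hz : z ∈ V) :
    ∃ a ∈ V.direction, ‖a‖ ≤ 1 ∧ ∀ y,
      |infDist z (V' : Set E) + ⟪a, y - z⟫| ≤ infDist y (V : Set E) + infDist y (V' : Set E) := by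
  set D := V.direction
  set D' := V'.direction
  set w : E := (z - q') - D'.starProjection (z - q') with hw
  have ht : infDist z (V' : Set E) = ‖w‖ := infDist_eq_norm_sub_starProjection V' hq' z
  set u : E := ‖w‖⁻¹ • w with hu
  have hwD : ∀ v ∈ D', ⟪w, v⟫ = 0 := fun v hv => Submodule.starProjection_inner_eq_zero _ _ hv
  have huD : ∀ v ∈ D', ⟪u, v⟫ = 0 := fun v hv => by rw [hu, inner_smul_left, hwD v hv, mul_zero]
  have hu1 : ‖u‖ ≤ 1 := by
    rw [hu, norm_smul, norm_inv, norm_norm]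
    exact inv_mul_le_one
  have huw : ⟪u, z - q'⟫ = ‖w‖ := by
    have h1 : z - q' = w + D'.starProjection (z - q') := by rw [hw]; abel
    rw [h1, inner_add_right, huD _ (Submodule.starProjection_apply_mem _ _), add_zero, hu,
      real_inner_smul_left, real_inner_self_eq_norm_sq]
    rcases eq_or_ne ‖w‖ 0 with h | h
    · simp [h]
    · field_simp
  refine ⟨D.starProjection u, Submodule.starProjection_apply_mem _ _,
    (Submodule.norm_starProjection_apply_le _ _).trans hu1, fun y => ?_⟩
  have h2 : ⟪D.starProjection u, y - z⟫ = ⟪u, y - z⟫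
      - ⟪u, (y - z) - D.starProjection (y - z)⟫ := by
    rw [inner_sub_right u (y - z) (D.starProjection _),
      Submodule.inner_starProjection_left_eq_right]
    ring
  have h3 : ⟪u, y - z⟫ = ⟪u, (y - q') - D'.starProjection (y - q')⟫ - ‖w‖ := by
    rw [inner_sub_right _ _ (D'.starProjection _), huD _ (Submodule.starProjection_apply_mem _ _),
      ← huw, sub_zero, ← inner_sub_right]
    congr 1
    abel
  have key : ∀ v : E, |⟪u, v⟫| ≤ ‖v‖ := fun v =>
    (abs_real_inner_le_norm u v).trans (mul_le_of_le_one_left (norm_nonneg v) hu1)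
  rw [ht, h2, h3, infDist_eq_norm_sub_starProjection V hz y,
    infDist_eq_norm_sub_starProjection V' hq' y]
  have k1 := abs_le.1 (key ((y - q') - D'.starProjection (y - q')))
  have k2 := abs_le.1 (key ((y - z) - D.starProjection (y - z)))
  exact abs_le.2 ⟨by linarith [k1.1, k2.2], by linarith [k1.2, k2.1]⟩

/-- A point of a ball that is close to an affine subspace passing near the centre of the ball is
close to a point of the subspace that lies inside the ball. -/
theorem exists_mem_inter_ball_dist_le (U : AffineSubspace ℝ E) {x p z : E} {ρ η : ℝ}
    (hη : η ≤ ρ / 8) (hp : p ∈ U) (hpx : dist p x ≤ 5 / 8 * ρ) (hz : z ∈ ball x ρ)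
    (hzU : infDist z (U : Set E) ≤ η) :
    ∃ w ∈ (U : Set E) ∩ ball x ρ, dist z w ≤ 13 * η := by
  have hρ : 0 < ρ := pos_of_mem_ball hz
  obtain ⟨z', hz', hzz'⟩ : ∃ z' ∈ (U : Set E), infDist z (U : Set E) = dist z z' :=
    (AffineSubspace.closed_of_finiteDimensional U).exists_infDist_eq_dist ⟨p, hp⟩ z
  rw [hzz'] at hzU
  have hη0 : 0 ≤ η := dist_nonneg.trans hzU
  rw [mem_ball] at hz
  have hz'x : dist z' x < ρ + η := by
    linarith [dist_triangle z' z x, dist_comm z' z]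
  set s : ℝ := 4 * η / ρ with hs
  have hsρ : s * ρ = 4 * η := by rw [hs]; field_simp
  have hs0 : 0 ≤ s := by positivity
  have hs1 : s ≤ 1 / 2 := by rw [hs, div_le_iff₀ hρ]; linarith
  refine ⟨AffineMap.lineMap z' p s, ⟨AffineMap.lineMap_mem s hz' hp, ?_⟩, ?_⟩
  · have h1 : AffineMap.lineMap z' p s - x = (1 - s) • (z' - x) + s • (p - x) := by
      rw [AffineMap.lineMap_apply_module]
      module
    rw [mem_ball, dist_eq_norm, h1]
    calc ‖(1 - s) • (z' - x) + s • (p - x)‖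
        ≤ (1 - s) * dist z' x + s * dist p x := by
          refine (norm_add_le _ _).trans_eq ?_
          rw [norm_smul, norm_smul, dist_eq_norm, dist_eq_norm, Real.norm_of_nonneg hs0,
            Real.norm_of_nonneg (by linarith)]
      _ < (1 - s) * (ρ + η) + s * (5 / 8 * ρ) := by
          have h2 := mul_lt_mul_of_pos_left hz'x (show 0 < 1 - s by linarith)
          have h3 := mul_le_mul_of_nonneg_left hpx hs0
          linarith
      _ ≤ ρ := by nlinarith [mul_nonneg hs0 hη0]
  · have h1 : dist z' (AffineMap.lineMap z' p s) = s * dist z' p := by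
      rw [dist_left_lineMap, Real.norm_of_nonneg hs0]
    have h2 : dist z' p ≤ 3 * ρ := by
      linarith [dist_triangle z' x p, dist_comm x p]
    have h3 := mul_le_mul_of_nonneg_left h2 hs0
    linarith [dist_triangle z z' (AffineMap.lineMap z' p s)]

theorem hausdorffDist_le_of_subset_ball {X : Type*} [PseudoMetricSpace X] {A B : Set X} {x : X}
    {ρ : ℝ} (hρ : 0 ≤ ρ) (hA : A ⊆ ball x ρ) (hB : B ⊆ ball x ρ) :
    hausdorffDist A B ≤ 2 * ρ := by
  rcases A.eq_empty_or_nonempty with rfl | ⟨a, ha⟩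
  · simpa using hρ
  rcases B.eq_empty_or_nonempty with rfl | ⟨b, hb⟩
  · simpa using hρ
  have key : ∀ y ∈ ball x ρ, ∀ y' ∈ ball x ρ, dist y y' ≤ 2 * ρ := fun y hy y' hy' => by
    rw [mem_ball] at hy hy'
    linarith [dist_triangle_right y y' x]
  exact hausdorffDist_le_of_mem_dist (by positivity) (fun y hy => ⟨b, hb, key y (hA hy) b (hB hb)⟩)
    (fun y hy => ⟨a, ha, key y (hB hy) a (hA ha)⟩)

/-- If two affine subspaces are `η`-close to each other inside a ball and one of them passes near
the centre, then their traces on the ball are at Hausdorff distance at most `16 η`. -/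
theorem hausdorffDist_inter_ball_le (V V' : AffineSubspace ℝ E) (hV' : (V' : Set E).Nonempty)
    {x : E} {ρ η : ℝ} (hρ : 0 < ρ) (hη : 0 ≤ η)
    (hx : infDist x ((V : Set E) ∩ ball x ρ) < ρ / 2)
    (h1 : ∀ z ∈ (V : Set E) ∩ ball x ρ, infDist z (V' : Set E) ≤ η)
    (h2 : ∀ z ∈ (V' : Set E) ∩ ball x ρ, infDist z (V : Set E) ≤ η) :
    hausdorffDist ((V : Set E) ∩ ball x ρ) ((V' : Set E) ∩ ball x ρ) ≤ 16 * η := by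
  rcases ((V : Set E) ∩ ball x ρ).eq_empty_or_nonempty with hA | hA
  · rw [hA, hausdorffDist_empty']
    positivity
  rcases lt_or_ge (ρ / 8) η with hlt | hle
  · have := hausdorffDist_le_of_subset_ball hρ.le
      (Set.inter_subset_right (s := (V : Set E)) (t := ball x ρ))
      (Set.inter_subset_right (s := (V' : Set E)))
    linarith
  obtain ⟨p, hp, hpx⟩ := (infDist_lt_iff hA).1 hx
  obtain ⟨p', hp', hpp'⟩ : ∃ p' ∈ (V' : Set E), infDist p (V' : Set E) = dist p p' :=
    (AffineSubspace.closed_of_finiteDimensional V').exists_infDist_eq_dist hV' p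
  have h3 := h1 p hp
  rw [hpp'] at h3
  have hp'x : dist p' x ≤ 5 / 8 * ρ := by
    linarith [dist_triangle p' p x, dist_comm p' p, dist_comm p x]
  have hpx' : dist p x ≤ 5 / 8 * ρ := by linarith [dist_comm p x]
  refine hausdorffDist_le_of_mem_dist (by positivity) (fun z hz => ?_) (fun z hz => ?_)
  · obtain ⟨w, hw, hzw⟩ := exists_mem_inter_ball_dist_le V' hle hp' hp'x hz.2 (h1 z hz)
    exact ⟨w, hw, by linarith⟩
  · obtain ⟨w, hw, hzw⟩ := exists_mem_inter_ball_dist_le V hle hp.1 hpx' hz.2 (h2 z hz)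
    exact ⟨w, hw, by linarith⟩

/-- A subset of a ball of radius `r` that is thin in the directions orthogonal to a
`j`-dimensional subspace is covered by few balls of radius `s` centred on the set. -/
theorem exists_finset_cover_of_thin (F : Submodule ℝ E) {x : E} {r s : ℝ} (hs : 0 < s)
    (hsr : s ≤ r) {S : Set E} (hS : S ⊆ ball x r)
    (hthin : ∀ y ∈ S, ∀ y' ∈ S, ‖(y - y') - F.starProjection (y - y')‖ ≤ s / 2) :
    ∃ T : Finset E, (T : Set E) ⊆ S ∧ S ⊆ ⋃ y ∈ T, ball y s ∧
      (T.card : ℝ) ≤ ((4 * Module.finrank ℝ F + 7) * (r / s)) ^ Module.finrank ℝ F := by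
  set j := Module.finrank ℝ F
  set b : OrthonormalBasis (Fin j) ℝ F := stdOrthonormalBasis ℝ F
  set e : ℝ := s / (2 * (j + 1)) with he
  have he0 : 0 < e := by positivity
  set c : E → Fin j → ℤ := fun y i => ⌊⟪(b i : E), y - x⟫ / e⌋ with hc
  set L : ℤ := ⌈r / e⌉ with hL
  set G : Finset (Fin j → ℤ) := Fintype.piFinset fun _ => Finset.Icc (-L) L
  have hcG : c '' S ⊆ G := by
    rintro _ ⟨y, hy, rfl⟩
    rw [Finset.mem_coe, Fintype.mem_piFinset]
    intro i
    have h1 : |⟪(b i : E), y - x⟫| < r := by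
      have hb : ‖(b i : E)‖ = 1 := b.orthonormal.1 i
      have := abs_real_inner_le_norm (b i : E) (y - x)
      rw [hb, one_mul, ← dist_eq_norm] at this
      exact this.trans_lt (hS hy)
    have h2 := abs_lt.1 h1
    have h3 : r / e ≤ L := Int.le_ceil _
    rw [Finset.mem_Icc]
    constructor
    · rw [hc, Int.le_floor]
      push_cast
      have : -(r / e) ≤ ⟪(b i : E), y - x⟫ / e := by
        rw [← neg_div]
        exact div_le_div_of_nonneg_right h2.1.le he0.le
      linarith
    · rw [hc]
      have h4 : (⌊⟪(b i : E), y - x⟫ / e⌋ : ℝ) ≤ L :=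
        (Int.floor_le _).trans ((div_le_div_of_nonneg_right h2.2.le he0.le).trans h3)
      exact_mod_cast h4
  obtain ⟨T, hTS, hT⟩ := Set.exists_subset_bijOn S c
  have hTfin : T.Finite := by
    apply Set.Finite.of_finite_image _ hT.injOn
    rw [hT.image_eq]
    exact G.finite_toSet.subset hcG
  have hcell : ∀ y ∈ S, ∀ y' ∈ S, c y = c y' → dist y y' < s := by
    intro y hy y' hy' hyy'
    have hcoord : ∀ i, |⟪(b i : E), y - y'⟫| ≤ e := by
      intro i
      have h1 : |⟪(b i : E), y - x⟫ / e - ⟪(b i : E), y' - x⟫ / e| < 1 :=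
        Int.abs_sub_lt_one_of_floor_eq_floor (congrFun hyy' i)
      rw [← sub_div, ← inner_sub_right, sub_sub_sub_cancel_right, abs_div, abs_of_pos he0,
        div_lt_one he0] at h1
      exact h1.le
    have hF : ‖F.starProjection (y - y')‖ ≤ j * e := by
      have h1 := b.sum_repr (F.orthogonalProjectionOnto (y - y'))
      rw [Submodule.starProjection_apply, ← h1]
      push_cast
      refine (norm_sum_le _ _).trans ?_
      refine (Finset.sum_le_card_nsmul _ _ e fun i _ => ?_).trans_eq (by simp)
      rw [norm_smul, b.repr_apply_apply]
      have hb : ‖(b i : E)‖ = 1 := b.orthonormal.1 i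
      rw [hb, mul_one, Real.norm_eq_abs, Submodule.coe_inner]
      have h2 : ⟪(b i : E), (F.orthogonalProjectionOnto (y - y') : E)⟫
          = ⟪(b i : E), y - y'⟫ := by
        rw [← Submodule.starProjection_apply, ← Submodule.inner_starProjection_left_eq_right,
          Submodule.starProjection_eq_self_iff.2 (b i).2]
      rw [h2]
      exact hcoord i
    have hje : j * e < s / 2 := by
      rw [he, ← mul_div_assoc, div_lt_div_iff₀ (by positivity) (by norm_num)]
      nlinarith
    have h3 := hthin y hy y' hy'
    have h4 := norm_add_le ((y - y') - F.starProjection (y - y')) (F.starProjection (y - y'))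
    rw [sub_add_cancel, ← dist_eq_norm] at h4
    linarith
  refine ⟨hTfin.toFinset, by simpa using hTS, fun y hy => ?_, ?_⟩
  · obtain ⟨y', hy', hyy'⟩ := hT.surjOn ⟨y, hy, rfl⟩
    simp only [Set.Finite.mem_toFinset, Set.mem_iUnion, mem_ball]
    exact ⟨y', hy', hcell y hy y' (hTS hy') hyy'.symm⟩
  · have h1 : hTfin.toFinset.card ≤ G.card := by
      refine Finset.card_le_card_of_injOn c (fun y hy => hcG ?_) ?_
      · exact ⟨y, hTS (by simpa using hy), rfl⟩
      · simpa using hT.injOn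
    have hrs : 1 ≤ r / s := (one_le_div hs).2 hsr
    have hL0 : 0 ≤ L := Int.ceil_nonneg (div_nonneg (hs.le.trans hsr) he0.le)
    have h2 : (G.card : ℝ) = (2 * L + 1 : ℝ) ^ j := by
      rw [Fintype.card_piFinset]
      simp only [Int.card_Icc, Finset.prod_const, Finset.card_univ, Fintype.card_fin]
      push_cast
      congr 1
      have h5 : ((L + 1 - -L).toNat : ℤ) = 2 * L + 1 := by
        rw [Int.toNat_of_nonneg (by linarith)]
        ring
      exact_mod_cast h5
    have h3 : (2 * L + 1 : ℝ) ≤ (4 * j + 7) * (r / s) := by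
      have h4 : (L : ℝ) < r / e + 1 := Int.ceil_lt_add_one _
      have h5 : r / e = 2 * (j + 1) * (r / s) := by
        rw [he]
        field_simp
      rw [h5] at h4
      nlinarith
    have hL0' : (0 : ℝ) ≤ L := by exact_mod_cast hL0
    calc (hTfin.toFinset.card : ℝ) ≤ G.card := by exact_mod_cast h1
      _ = (2 * L + 1 : ℝ) ^ j := h2
      _ ≤ _ := pow_le_pow_left₀ (by positivity) h3 _

end Geometry

theorem inv_pow_self_le_omegaK (k : ℕ) : ((k : ℝ) ^ k)⁻¹ ≤ omegaK k := by
  rcases Nat.eq_zero_or_pos k with rfl | hk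
  · have h1 : ball (0 : EuclideanSpace ℝ (Fin 0)) 1 = Set.univ :=
      Set.eq_univ_of_forall fun y => by simp [Subsingleton.elim y 0]
    have h2 : volume (Set.univ : Set (EuclideanSpace ℝ (Fin 0))) = 1 := by
      rw [← (PiLp.volume_preserving_toLp (Fin 0)).measure_preimage
        MeasurableSet.univ.nullMeasurableSet, Set.preimage_univ]
      simp [volume_pi]
    simp [omegaK, h1, h2]
  · have : Nonempty (Fin k) := ⟨⟨0, hk⟩⟩
    have hG : Real.Gamma ((k : ℝ) / 2 + 1) ≤ (k : ℝ) ^ k := by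
      have h1 := Real.Gamma_mul_add_mul_le_rpow_Gamma_mul_rpow_Gamma (s := 1) (t := (k : ℝ) + 1)
        (a := 1 / 2) (b := 1 / 2) one_pos (by positivity) (by norm_num) (by norm_num) (by norm_num)
      rw [show (1 : ℝ) / 2 * 1 + 1 / 2 * (k + 1) = k / 2 + 1 by ring, Real.Gamma_one,
        Real.one_rpow, one_mul, Real.Gamma_nat_eq_factorial] at h1
      have h2 : (1 : ℝ) ≤ k.factorial := by exact_mod_cast k.factorial_pos
      calc Real.Gamma ((k : ℝ) / 2 + 1) ≤ (k.factorial : ℝ) ^ (1 / 2 : ℝ) := h1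
        _ ≤ (k.factorial : ℝ) ^ (1 : ℝ) := Real.rpow_le_rpow_of_exponent_le h2 (by norm_num)
        _ = k.factorial := Real.rpow_one _
        _ ≤ (k : ℝ) ^ k := by exact_mod_cast k.factorial_le_pow
    have hG0 : 0 < Real.Gamma ((k : ℝ) / 2 + 1) := Real.Gamma_pos_of_pos (by positivity)
    have hpi : 1 ≤ √Real.pi ^ k :=
      one_le_pow₀ (Real.one_le_sqrt.2 (by linarith [Real.pi_gt_three]))
    rw [omegaK, EuclideanSpace.volume_ball, ENNReal.ofReal_one, one_pow, one_mul, Fintype.card_fin,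
      ENNReal.toReal_ofReal (by positivity), ← one_div]
    exact div_le_div₀ (by positivity) hpi hG0 hG

theorem gammaK_pos (k : ℕ) : 0 < gammaK k := by
  have h1 : 0 < ((k : ℝ) ^ k)⁻¹ := by
    rcases Nat.eq_zero_or_pos k with rfl | hk
    · simp
    · positivity
  exact mul_pos (h1.trans_le (inv_pow_self_le_omegaK k)) (by positivity)

theorem epsN_le_gammaK {n k : ℕ} (hk : k ≤ n) : epsN n ≤ gammaK k := by
  have hω : ((40 * (k : ℝ)) ^ k)⁻¹ ≤ gammaK k := by
    rw [gammaK, mul_pow, mul_inv_rev, zpow_neg, zpow_natCast]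
    exact mul_le_mul_of_nonneg_right (inv_pow_self_le_omegaK k) (by positivity)
  refine le_trans ?_ hω
  have hpow : epsN n = ((1000 * (n : ℝ)) ^ (7 * n ^ 2))⁻¹ := by
    rw [epsN, zpow_neg, ← zpow_natCast]
    push_cast
    rfl
  rw [hpow]
  rcases Nat.eq_zero_or_pos k with rfl | hk0
  · rw [pow_zero, inv_one]
    rcases Nat.eq_zero_or_pos n with rfl | hn
    · simp
    · have : (1 : ℝ) ≤ n := by exact_mod_cast hn
      exact inv_le_one_of_one_le₀ (one_le_pow₀ (by linarith))
  · have hk1 : (1 : ℝ) ≤ k := by exact_mod_cast hk0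
    have hkn : (k : ℝ) ≤ n := by exact_mod_cast hk
    apply inv_anti₀ (by positivity)
    calc (40 * (k : ℝ)) ^ k ≤ (1000 * (n : ℝ)) ^ k :=
          pow_le_pow_left₀ (by positivity) (by linarith) _
      _ ≤ (1000 * (n : ℝ)) ^ (7 * n ^ 2) := pow_le_pow_right₀ (by linarith) (by nlinarith)

theorem dispInf_nonneg (n k : ℕ) (μ : Measure (EuclideanSpace ℝ (Fin n)))
    (x : EuclideanSpace ℝ (Fin n)) (r : ℝ) : 0 ≤ dispInf n k μ x r := by
  apply Real.sInf_nonneg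
  rintro _ ⟨L, -, rfl⟩
  exact integral_nonneg fun _ => sq_nonneg _

/-- On balls of radius at most one and of large measure the displacement bounds the integral of
the squared distance to an optimal plane. -/
theorem setIntegral_infDist_sq_le_disp {n k : ℕ} (hk : k ≤ n)
    {μ : Measure (EuclideanSpace ℝ (Fin n))} {x : EuclideanSpace ℝ (Fin n)} {r : ℝ} (hr : 0 < r)
    (hr1 : r ≤ 1) (hμ : ENNReal.ofReal (gammaK k * r ^ k) ≤ μ (ball x r))
    {V : AffineSubspace ℝ (EuclideanSpace ℝ (Fin n))} (hV : IsAffineSubspaceDim n k V)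
    (hmin : ∀ L : AffineSubspace ℝ (EuclideanSpace ℝ (Fin n)), IsAffineSubspaceDim n k L →
      ∫ y in ball x r, infDist y (V : Set (EuclideanSpace ℝ (Fin n))) ^ 2 ∂μ ≤
        ∫ y in ball x r, infDist y (L : Set (EuclideanSpace ℝ (Fin n))) ^ 2 ∂μ) :
    ∫ y in ball x r, infDist y (V : Set (EuclideanSpace ℝ (Fin n))) ^ 2 ∂μ ≤ disp n k μ x r := by
  have hthreshold : ENNReal.ofReal (epsN n * r ^ k) ≤ μ (ball x r) :=
    (ENNReal.ofReal_le_ofReal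
      (mul_le_mul_of_nonneg_right (epsN_le_gammaK hk) (by positivity))).trans hμ
  have h1 : ∫ y in ball x r, infDist y (V : Set (EuclideanSpace ℝ (Fin n))) ^ 2 ∂μ
      ≤ dispInf n k μ x r := by
    refine le_csInf ⟨_, V, hV, rfl⟩ ?_
    rintro _ ⟨L, hL, rfl⟩
    exact hmin L hL
  have h2 : 1 ≤ r ^ (-((k : ℤ) + 2)) := by
    rw [zpow_neg]
    exact one_le_inv_iff₀.2 ⟨by positivity, by
      have : r ^ ((k : ℤ) + 2) = r ^ (k + 2) := by norm_cast
      rw [this]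
      exact pow_le_one₀ hr.le hr1⟩
  rw [disp, if_pos hthreshold]
  exact h1.trans (le_mul_of_one_le_left (dispInf_nonneg n k μ x r) h2)

section Measure

variable {E : Type*} [NormedAddCommGroup E] [InnerProductSpace ℝ E] [FiniteDimensional ℝ E]
  [MeasurableSpace E]

theorem measure_le_of_thin (μ : Measure E) (F : Submodule ℝ E) {x : E} {r s m : ℝ} (hs : 0 < s)
    (hsr : s ≤ r) (hm : 0 ≤ m) {S : Set E} (hS : S ⊆ ball x r)
    (hthin : ∀ y ∈ S, ∀ y' ∈ S, ‖(y - y') - F.starProjection (y - y')‖ ≤ s / 2)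
    (hμ : ∀ y ∈ S, μ (ball y s) ≤ ENNReal.ofReal m) :
    μ S ≤ ENNReal.ofReal
      (((4 * Module.finrank ℝ F + 7) * (r / s)) ^ Module.finrank ℝ F * m) := by
  obtain ⟨T, hTS, hcov, hcard⟩ := exists_finset_cover_of_thin F hs hsr hS hthin
  calc μ S ≤ ∑ y ∈ T, μ (ball y s) := (measure_mono hcov).trans (measure_biUnion_finset_le _ _)
    _ ≤ T.card • ENNReal.ofReal m := Finset.sum_le_card_nsmul _ _ _ fun y hy => hμ y (hTS hy)
    _ = ENNReal.ofReal (T.card * m) := by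
        rw [nsmul_eq_mul, ENNReal.ofReal_mul (by positivity), ENNReal.ofReal_natCast]
    _ ≤ _ := ENNReal.ofReal_le_ofReal (mul_le_mul_of_nonneg_right hcard hm)

/-- A measure with controlled mass at scale `ρ ^ 2` has little mass near a hyperplane of a
`k`-dimensional affine subspace. -/
theorem measure_sublevel_le (μ : Measure E) (V : AffineSubspace ℝ E) {k : ℕ}
    (hV : Module.finrank ℝ V.direction = k) {M ρ : ℝ} (hM : 0 ≤ M) (hρ : 0 < ρ) (hρ1 : ρ ≤ 1)
    {x z a : E} (hz : z ∈ V) (haV : a ∈ V.direction) (ha0 : a ≠ 0) (ha1 : ‖a‖ ≤ 1) {t : ℝ}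
    {f : E → ℝ} (hf : ∀ y, |t + ⟪a, y - z⟫| ≤ f y) (hVf : ∀ y, infDist y (V : Set E) ≤ f y)
    (hμ : ∀ y ∈ ball x ρ, μ (ball y (ρ ^ 2)) ≤ ENNReal.ofReal (M * ρ ^ (2 * k))) :
    μ ({y | f y < ρ ^ 2 / 8 * ‖a‖} ∩ ball x ρ)
      ≤ ENNReal.ofReal ((4 * k + 3) ^ (k - 1) * M * ρ ^ (k + 1)) := by
  set D := V.direction
  set F : Submodule ℝ E := (ℝ ∙ a)ᗮ ⊓ D
  have hanorm : 0 < ‖a‖ := norm_pos_iff.2 ha0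
  obtain ⟨j, rfl⟩ : ∃ j, k = j + 1 := by
    have h1 : (ℝ ∙ a) ≤ D := by simpa using haV
    have h2 := Submodule.finrank_mono h1
    rw [finrank_span_singleton ha0] at h2
    exact ⟨k - 1, by omega⟩
  have hF : Module.finrank ℝ F = j := by
    have h1 : (ℝ ∙ a) ≤ D := by simpa using haV
    have h2 := Submodule.finrank_add_inf_finrank_orthogonal h1
    rw [finrank_span_singleton ha0, hV] at h2
    exact Nat.add_left_cancel (h2.trans (add_comm j 1))
  have hthin : ∀ y ∈ {y | f y < ρ ^ 2 / 8 * ‖a‖} ∩ ball x ρ,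
      ∀ y' ∈ {y | f y < ρ ^ 2 / 8 * ‖a‖} ∩ ball x ρ,
      ‖(y - y') - F.starProjection (y - y')‖ ≤ ρ ^ 2 / 2 := by
    rintro y ⟨hy, -⟩ y' ⟨hy', -⟩
    rw [Set.mem_ofPred_eq] at hy hy'
    set v := y - y' with hv
    set w := D.starProjection v - (⟪a, v⟫ / ‖a‖ ^ 2) • a with hw
    have hwF : w ∈ F := by
      refine Submodule.mem_inf.2 ⟨Submodule.mem_orthogonal_singleton_iff_inner_right.2 ?_,
        D.sub_mem (Submodule.starProjection_apply_mem _ _) (D.smul_mem _ haV)⟩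
      rw [hw, inner_sub_right, inner_smul_right, real_inner_self_eq_norm_sq,
        ← Submodule.inner_starProjection_left_eq_right,
        Submodule.starProjection_eq_self_iff.2 haV]
      field_simp
      simp
    have h1 : v - F.starProjection v = (v - w) - F.starProjection (v - w) := by
      rw [map_sub _ v, Submodule.starProjection_eq_self_iff.2 hwF]
      abel
    have h2 : v - w = (v - D.starProjection v) + (⟪a, v⟫ / ‖a‖ ^ 2) • a := by
      rw [hw]
      abel
    have h3 : v - D.starProjection v = ((y - z) - D.starProjection (y - z))
        - ((y' - z) - D.starProjection (y' - z)) := by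
      have h4 : v = (y - z) - (y' - z) := by rw [hv]; abel
      rw [h4, map_sub D.starProjection (y - z)]
      abel
    have h5 : ‖v - D.starProjection v‖ ≤ ρ ^ 2 / 8 + ρ ^ 2 / 8 := by
      rw [h3]
      refine (norm_sub_le _ _).trans ?_
      rw [← infDist_eq_norm_sub_starProjection V hz, ← infDist_eq_norm_sub_starProjection V hz]
      have h6 : ρ ^ 2 / 8 * ‖a‖ ≤ ρ ^ 2 / 8 := mul_le_of_le_one_right (by positivity) ha1
      linarith [hVf y, hVf y']
    have h7 : ‖(⟪a, v⟫ / ‖a‖ ^ 2) • a‖ ≤ ρ ^ 2 / 8 + ρ ^ 2 / 8 := by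
      have h8 : ⟪a, v⟫ = (t + ⟪a, y - z⟫) - (t + ⟪a, y' - z⟫) := by
        rw [add_sub_add_left_eq_sub, ← inner_sub_right, hv]
        congr 1
        abel
      have h9 : |⟪a, v⟫| ≤ (ρ ^ 2 / 8 + ρ ^ 2 / 8) * ‖a‖ := by
        rw [h8]
        refine (abs_sub _ _).trans ?_
        linarith [hf y, hf y']
      rw [norm_smul, norm_div, norm_pow, norm_norm, Real.norm_eq_abs, div_mul_eq_mul_div,
        div_le_iff₀ (by positivity), pow_two ‖a‖, ← mul_assoc]
      exact mul_le_mul_of_nonneg_right h9 hanorm.le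
    rw [h1]
    refine (norm_sub_starProjection_le F _).trans ?_
    rw [h2]
    refine (norm_add_le _ _).trans ?_
    linarith
  have key := measure_le_of_thin μ F (pow_pos hρ 2)
    (by nlinarith : ρ ^ 2 ≤ ρ) (by positivity) Set.inter_subset_right hthin
    (fun y hy => hμ y hy.2)
  refine key.trans_eq ?_
  rw [hF]
  congr 1
  have h1 : ρ / ρ ^ 2 = ρ⁻¹ := by field_simp
  rw [h1, mul_pow, inv_pow]
  push_cast
  rw [show 4 * ((j : ℝ) + 1) + 3 = 4 * j + 7 by ring]
  have h2 : ρ ^ (2 * (j + 1)) = ρ ^ j * ρ ^ (j + 1 + 1) := by rw [← pow_add]; congr 1; omega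
  rw [h2]
  field_simp

variable [BorelSpace E]

theorem integrableOn_infDist_mul_infDist {μ : Measure E} {x : E} {ρ : ℝ} (V V' : AffineSubspace ℝ E)
    (hμ : μ (ball x ρ) ≠ ∞) :
    IntegrableOn (fun y => infDist y (V : Set E) * infDist y (V' : Set E)) (ball x ρ) μ := by
  have hcont : Continuous fun y => infDist y (V : Set E) * infDist y (V' : Set E) :=
    (continuous_infDist_pt _).mul (continuous_infDist_pt _)
  have : ProperSpace E := FiniteDimensional.proper ℝ E
  obtain ⟨C, hC⟩ := (isCompact_closedBall x ρ).exists_bound_of_continuousOn hcont.continuousOn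
  refine Measure.integrableOn_of_bounded hμ hcont.aestronglyMeasurable (M := C) ?_
  exact (ae_restrict_iff' measurableSet_ball).2
    (ae_of_all _ fun y hy => hC y (ball_subset_closedBall hy))

/-- If `μ` is not concentrated near hyperplanes of `V`, then the `L²`-distances to `V` and `V'`
control the distance of every point of `V` in the ball to `V'`. -/
theorem mul_infDist_sq_le (μ : Measure E) (V V' : AffineSubspace ℝ E) {k : ℕ}
    (hV : Module.finrank ℝ V.direction = k) (hV' : (V' : Set E).Nonempty) {M ρ : ℝ} (hM : 0 ≤ M)
    (hρ : 0 < ρ) (hρ1 : ρ ≤ 1) {x z : E} (hfin : μ (ball x ρ) ≠ ∞)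
    (hμ : ∀ y ∈ ball x ρ, μ (ball y (ρ ^ 2)) ≤ ENNReal.ofReal (M * ρ ^ (2 * k)))
    (hmass : 2 * ((4 * k + 3) ^ (k - 1) * M * ρ ^ (k + 1)) ≤ μ.real (ball x ρ))
    (hz : z ∈ (V : Set E) ∩ ball x ρ) :
    μ.real (ball x ρ) * (ρ ^ 2 / 8) ^ 2 * infDist z (V' : Set E) ^ 2 ≤
      (4 * (ρ ^ 2 / 8) ^ 2 + 32 * ρ ^ 2) *
        (∫ y in ball x ρ, infDist y (V : Set E) ^ 2 ∂μ +
          ∫ y in ball x ρ, infDist y (V' : Set E) ^ 2 ∂μ) := by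
  obtain ⟨q', hq'⟩ := hV'
  obtain ⟨a, haV, ha1, ha⟩ := exists_affine_le_infDist_add_infDist V V' hq' hz.1
  set δ : ℝ := ρ ^ 2 / 8 with hδ
  set m := μ.real (ball x ρ) with hm
  set t := infDist z (V' : Set E) with ht
  set f : E → ℝ := fun y => infDist y (V : Set E) + infDist y (V' : Set E) with hf
  have hδ0 : 0 < δ := by positivity
  have hm0 : 0 ≤ m := measureReal_nonneg
  have hf0 : ∀ y, 0 ≤ f y := fun y => add_nonneg infDist_nonneg infDist_nonneg
  have hfc : Continuous f := (continuous_infDist_pt _).add (continuous_infDist_pt _)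
  have hint : ∀ U : AffineSubspace ℝ E,
      IntegrableOn (fun y => infDist y (U : Set E) ^ 2) (ball x ρ) μ := fun U => by
    simpa only [pow_two] using integrableOn_infDist_mul_infDist U U hfin
  have hfint : IntegrableOn (fun y => f y ^ 2) (ball x ρ) μ := by
    have h1 := ((hint V).add ((integrableOn_infDist_mul_infDist V V' hfin).const_mul 2)).add
      (hint V')
    refine h1.congr (ae_of_all _ fun y => ?_)
    simp only [hf, Pi.add_apply]
    ring
  have hconst : ∀ c : ℝ, IntegrableOn (fun _ : E => c) (ball x ρ) μ := fun c =>
    integrableOn_const hfin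
  have hI : ∫ y in ball x ρ, f y ^ 2 ∂μ ≤ 2 * (∫ y in ball x ρ, infDist y (V : Set E) ^ 2 ∂μ +
      ∫ y in ball x ρ, infDist y (V' : Set E) ^ 2 ∂μ) := by
    rw [← integral_add (hint V) (hint V'), ← integral_const_mul]
    refine setIntegral_mono_on hfint (((hint V).add (hint V')).const_mul 2) measurableSet_ball
      fun y _ => ?_
    simp only [hf]
    nlinarith [sq_nonneg (infDist y (V : Set E) - infDist y (V' : Set E))]
  have hslope : m * (δ ^ 2 * ‖a‖ ^ 2) ≤ 2 * ∫ y in ball x ρ, f y ^ 2 ∂μ := by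
    rcases eq_or_ne a 0 with h0 | h0
    · have : 0 ≤ ∫ y in ball x ρ, f y ^ 2 ∂μ := integral_nonneg fun _ => sq_nonneg _
      simpa [h0] using this
    have h1 := measure_sublevel_le μ V hV hM hρ hρ1 hz.1 haV h0 ha1 ha
      (fun y => le_add_of_nonneg_right infDist_nonneg) hμ
    have h2 : μ.real ({y | f y < δ * ‖a‖} ∩ ball x ρ) ≤ m / 2 := by
      refine (ENNReal.toReal_le_of_le_ofReal (by positivity) h1).trans ?_
      linarith
    have h3 : MeasurableSet {y | f y < δ * ‖a‖} := measurableSet_lt hfc.measurable measurable_const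
    have : IsFiniteMeasure (μ.restrict (ball x ρ)) := isFiniteMeasure_restrict.2 hfin
    have h4 := mul_meas_ge_le_integral_of_nonneg (μ := μ.restrict (ball x ρ))
      (ae_of_all _ fun y => sq_nonneg (f y)) hfint ((δ * ‖a‖) ^ 2)
    have h5 : {y | (δ * ‖a‖) ^ 2 ≤ f y ^ 2} = {y | f y < δ * ‖a‖}ᶜ := by
      ext y
      simp only [Set.mem_ofPred_eq, Set.mem_compl_iff, not_lt]
      exact pow_le_pow_iff_left₀ (by positivity) (hf0 y) two_ne_zero
    rw [h5, measureReal_compl h3, measureReal_restrict_apply_univ,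
      measureReal_restrict_apply h3] at h4
    have h6 : (δ * ‖a‖) ^ 2 * (m / 2) ≤ (δ * ‖a‖) ^ 2
        * (m - μ.real ({y | f y < δ * ‖a‖} ∩ ball x ρ)) :=
      mul_le_mul_of_nonneg_left (by linarith) (by positivity)
    linarith
  have hvalue : m * t ^ 2 ≤ 2 * ∫ y in ball x ρ, f y ^ 2 ∂μ + m * (8 * ρ ^ 2 * ‖a‖ ^ 2) := by
    have h1 : ∫ _ in ball x ρ, t ^ 2 ∂μ
        ≤ ∫ y in ball x ρ, (2 * f y ^ 2 + 8 * ρ ^ 2 * ‖a‖ ^ 2) ∂μ := by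
      refine setIntegral_mono_on (hconst _) ((hfint.const_mul 2).add (hconst _)) measurableSet_ball
        fun y hy => ?_
      have h2 : ‖y - z‖ ≤ 2 * ρ := by
        rw [← dist_eq_norm]
        linarith [dist_triangle_right y z x, mem_ball.1 hy, mem_ball.1 hz.2]
      have h3 : |⟪a, y - z⟫| ≤ ‖a‖ * (2 * ρ) :=
        (abs_real_inner_le_norm _ _).trans (mul_le_mul_of_nonneg_left h2 (norm_nonneg a))
      have h4 : t ≤ f y + ‖a‖ * (2 * ρ) := by
        linarith [(abs_le.1 (ha y)).2, (abs_le.1 h3).1]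
      have h5 : t ^ 2 ≤ (f y + ‖a‖ * (2 * ρ)) ^ 2 := pow_le_pow_left₀ infDist_nonneg h4 2
      nlinarith [sq_nonneg (f y - ‖a‖ * (2 * ρ))]
    rw [integral_add (hfint.const_mul 2) (hconst _), integral_const_mul, setIntegral_const,
      setIntegral_const, smul_eq_mul, smul_eq_mul] at h1
    exact h1
  have h1 := mul_le_mul_of_nonneg_left hvalue (sq_nonneg δ)
  have h2 := mul_le_mul_of_nonneg_left hslope (show 0 ≤ 8 * ρ ^ 2 by positivity)
  have h3 := mul_le_mul_of_nonneg_left hI (show 0 ≤ 2 * δ ^ 2 + 16 * ρ ^ 2 by positivity)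
  linarith

end Measure

/-- **Distance between `L²`-best planes at nearby scales** (Lemma 4.8).
For `0 ≤ k ≤ n`, `M > 0` there is a threshold scale `ρ₀ > 0` such that for
`0 < ρ ≤ ρ₀` there is `c = c(n,ρ,M)`: if `μ` is a positive Radon measure supported in the
closed unit ball with `μ(B_1(0)) ≥ γ_k` and `μ(B_{ρ²}(y)) ≤ M ρ^{2k}` for all
`y ∈ B_1(0)`, `B_ρ(x) ⊆ B_1(0)` with `μ(B_ρ(x)) ≥ γ_k ρ^k`, `V(0,1)` and `V(x,ρ)` are
`k`-dimensional affine subspaces minimizing the `L²`-distance on `B_1(0)` resp. `B_ρ(x)`,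
`A := V(0,1) ∩ B_ρ(x)`, `B := V(x,ρ) ∩ B_ρ(x)` and `dist(x,A) < ρ/2`, then
`d_H(A,B)² ≤ c (D^k_μ(x,ρ) + D^k_μ(0,1))`. -/
theorem distance_between_best_planes (n k : ℕ) (hk : k ≤ n) (M : ℝ) (hM : 0 < M) :
    ∃ ρ₀ : ℝ, 0 < ρ₀ ∧ ∀ ρ : ℝ, 0 < ρ → ρ ≤ ρ₀ →
      ∃ c : ℝ, 0 < c ∧
      ∀ (μ : Measure (EuclideanSpace ℝ (Fin n))) (x : EuclideanSpace ℝ (Fin n))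
        (V01 Vxρ : AffineSubspace ℝ (EuclideanSpace ℝ (Fin n))),
        μ (closedBall (0 : EuclideanSpace ℝ (Fin n)) 1)ᶜ = 0 →
        ENNReal.ofReal (gammaK k) ≤ μ (ball (0 : EuclideanSpace ℝ (Fin n)) 1) →
        (∀ y ∈ ball (0 : EuclideanSpace ℝ (Fin n)) 1,
          μ (ball y (ρ ^ 2)) ≤ ENNReal.ofReal (M * ρ ^ (2 * k))) →
        ball x ρ ⊆ ball (0 : EuclideanSpace ℝ (Fin n)) 1 →
        ENNReal.ofReal (gammaK k * ρ ^ k) ≤ μ (ball x ρ) →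
        IsAffineSubspaceDim n k V01 →
        (∀ L : AffineSubspace ℝ (EuclideanSpace ℝ (Fin n)), IsAffineSubspaceDim n k L →
          ∫ y in ball (0 : EuclideanSpace ℝ (Fin n)) 1,
              infDist y (V01 : Set (EuclideanSpace ℝ (Fin n))) ^ 2 ∂μ ≤
            ∫ y in ball (0 : EuclideanSpace ℝ (Fin n)) 1,
              infDist y (L : Set (EuclideanSpace ℝ (Fin n))) ^ 2 ∂μ) →
        IsAffineSubspaceDim n k Vxρ →
        (∀ L : AffineSubspace ℝ (EuclideanSpace ℝ (Fin n)), IsAffineSubspaceDim n k L →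
          ∫ y in ball x ρ, infDist y (Vxρ : Set (EuclideanSpace ℝ (Fin n))) ^ 2 ∂μ ≤
            ∫ y in ball x ρ, infDist y (L : Set (EuclideanSpace ℝ (Fin n))) ^ 2 ∂μ) →
        infDist x ((V01 : Set (EuclideanSpace ℝ (Fin n))) ∩ ball x ρ) < ρ / 2 →
        hausdorffDist ((V01 : Set (EuclideanSpace ℝ (Fin n))) ∩ ball x ρ)
            ((Vxρ : Set (EuclideanSpace ℝ (Fin n))) ∩ ball x ρ) ^ 2 ≤
          c * (disp n k μ x ρ + disp n k μ 0 1) := by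
  have hγ := gammaK_pos k
  set K : ℝ := 2 * ((4 * k + 3) ^ (k - 1) * M) with hK
  have hK0 : 0 < K := by positivity
  refine ⟨min 1 (gammaK k / K), lt_min one_pos (by positivity), fun ρ hρ hρ₀ => ?_⟩
  have hρ1 : ρ ≤ 1 := hρ₀.trans (min_le_left _ _)
  have hρK : ρ * K ≤ gammaK k := (le_div_iff₀ hK0).1 (hρ₀.trans (min_le_right _ _))
  set δ : ℝ := ρ ^ 2 / 8 with hδ
  set C : ℝ := (4 * δ ^ 2 + 32 * ρ ^ 2) / (gammaK k * ρ ^ k * δ ^ 2) with hC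
  have hC0 : 0 < C := by positivity
  refine ⟨256 * C, by positivity, ?_⟩
  intro μ x V01 Vxρ _ hμ1 hμM hxB hμx hV01 hmin01 hVxρ hminxρ hdist
  have hball : ∀ y ∈ ball x ρ, μ (ball y (ρ ^ 2)) ≤ ENNReal.ofReal (M * ρ ^ (2 * k)) :=
    fun y hy => hμM y (hxB hy)
  have hfin1 : μ (ball (0 : EuclideanSpace ℝ (Fin n)) 1) ≠ ∞ := by
    obtain ⟨T, hT, hTfin, hcov⟩ := exists_finite_cover_balls_of_isCompact_closure
      (isBounded_ball (x := (0 : EuclideanSpace ℝ (Fin n))) (r := 1)).isCompact_closure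
      (pow_pos hρ 2)
    refine ((measure_mono hcov).trans_lt (measure_biUnion_lt_top hTfin fun y hy => ?_)).ne
    exact (hμM y (hT hy)).trans_lt ENNReal.ofReal_lt_top
  have hfin : μ (ball x ρ) ≠ ∞ := ne_top_of_le_ne_top hfin1 (measure_mono hxB)
  have hmass : gammaK k * ρ ^ k ≤ μ.real (ball x ρ) :=
    (ENNReal.ofReal_le_iff_le_toReal hfin).1 hμx
  have hsmall : 2 * ((4 * k + 3) ^ (k - 1) * M * ρ ^ (k + 1)) ≤ μ.real (ball x ρ) := by
    refine le_trans ?_ hmass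
    calc 2 * ((4 * k + 3) ^ (k - 1) * M * ρ ^ (k + 1)) = ρ * K * ρ ^ k := by rw [hK]; ring
      _ ≤ gammaK k * ρ ^ k := mul_le_mul_of_nonneg_right hρK (by positivity)
  have hIx := setIntegral_infDist_sq_le_disp hk hρ hρ1 hμx hVxρ hminxρ
  have hI0 : ∫ y in ball x ρ, infDist y (V01 : Set (EuclideanSpace ℝ (Fin n))) ^ 2 ∂μ
      ≤ disp n k μ 0 1 := by
    refine (setIntegral_mono_set ?_ (ae_of_all _ fun _ => sq_nonneg _) hxB.eventuallyLE).trans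
      (setIntegral_infDist_sq_le_disp hk one_pos le_rfl (by simpa using hμ1) hV01 hmin01)
    simpa only [pow_two] using integrableOn_infDist_mul_infDist V01 V01 hfin1
  set S := disp n k μ x ρ + disp n k μ 0 1 with hS
  have hS0 : 0 ≤ S := by
    refine le_trans (add_nonneg ?_ ?_) (add_le_add hIx hI0) <;>
      exact integral_nonneg fun _ => sq_nonneg _
  have hclose : ∀ (V V' : AffineSubspace ℝ (EuclideanSpace ℝ (Fin n))),
      IsAffineSubspaceDim n k V → IsAffineSubspaceDim n k V' →
      ∫ y in ball x ρ, infDist y (V : Set (EuclideanSpace ℝ (Fin n))) ^ 2 ∂μ +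
        ∫ y in ball x ρ, infDist y (V' : Set (EuclideanSpace ℝ (Fin n))) ^ 2 ∂μ ≤ S →
      ∀ z ∈ (V : Set (EuclideanSpace ℝ (Fin n))) ∩ ball x ρ,
        infDist z (V' : Set (EuclideanSpace ℝ (Fin n))) ≤ √(C * S) := by
    intro V V' hV hV' hVV' z hz
    have h1 := mul_infDist_sq_le μ V V' hV.2 hV'.1 hM.le hρ hρ1 hfin hball hsmall hz
    apply Real.le_sqrt_of_sq_le
    rw [hC, div_mul_eq_mul_div, le_div_iff₀ (by positivity)]
    calc infDist z (V' : Set (EuclideanSpace ℝ (Fin n))) ^ 2 * (gammaK k * ρ ^ k * δ ^ 2)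
        = gammaK k * ρ ^ k * (δ ^ 2 * infDist z (V' : Set (EuclideanSpace ℝ (Fin n))) ^ 2) := by
          ring
      _ ≤ μ.real (ball x ρ) * (δ ^ 2 * infDist z (V' : Set (EuclideanSpace ℝ (Fin n))) ^ 2) :=
          mul_le_mul_of_nonneg_right hmass (by positivity)
      _ ≤ _ := by
          rw [← mul_assoc]
          exact h1.trans (mul_le_mul_of_nonneg_left hVV' (by positivity))
  have hfinal := hausdorffDist_inter_ball_le V01 Vxρ hVxρ.1 hρ (Real.sqrt_nonneg (C * S)) hdist
    (hclose V01 Vxρ hV01 hVxρ (by linarith)) (hclose Vxρ V01 hVxρ hV01 (by linarith))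
  calc _ ≤ (16 * √(C * S)) ^ 2 := pow_le_pow_left₀ hausdorffDist_nonneg hfinal 2
    _ = 256 * C * S := by
        rw [mul_pow, Real.sq_sqrt (by positivity)]
        ring
end
end

section
/- Decomposition of a Vitali family of balls into boundedly many radius-separated subfamilies (Lemma 7.4): For each n and each R ≥ 5 there exists N = N(n,R) with the following property. Let {B_{r_i}(x_i)}_{i ∈ J} be a countable collection of balls contained in B_2(0) ⊆ ℝⁿ such that the balls {B_{r_i/5}(x_i)}_{i ∈ J} are pairwise disjoint. Then there is a partition J = J¹ ∪ ⋯ ∪ J^N such that for each a and all i, j ∈ J^a with i ≠ j: if x_j ∈ B_{R r_i}(x_i), then r_j < R^{−2} r_i. -/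
open MeasureTheory Metric
open scoped ENNReal NNReal RealInnerProductSpace

noncomputable section

/-- Greedy coloring: a symmetric irreflexive relation all of whose neighborhoods have at most `M`
elements admits a proper coloring with `M + 1` colors. -/
theorem exists_coloring_of_encard_le {J : Type*} (A : J → J → Prop) (hsymm : ∀ i j, A i j → A j i)
    (hirr : ∀ i, ¬ A i i) (M : ℕ) (hM : ∀ i, {j | A i j}.encard ≤ M) :
    ∃ f : J → Fin (M + 1), ∀ i j, A i j → f i ≠ f j := by
  have hwf : WellFounded (WellOrderingRel : J → J → Prop) := WellOrderingRel.isWellOrder.wf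
  have avoid : ∀ (i : J) (g : ∀ j, WellOrderingRel j i → Fin (M + 1)),
      ∃ c, ∀ j (h : WellOrderingRel j i), A i j → g j h ≠ c := by
    intro i g
    by_contra! hg
    choose φ hφlt hφA hφ using hg
    have hinj : Function.Injective φ := by
      intro c d hcd
      rw [← hφ c, ← hφ d]
      congr 1
    have hle : (Set.univ : Set (Fin (M + 1))).encard ≤ {j | A i j}.encard :=
      Set.encard_le_encard_of_injOn (fun c _ => hφA c) hinj.injOn
    have hcard := hle.trans (hM i)
    rw [Set.encard_univ, ENat.card_eq_coe_fintype_card, Fintype.card_fin] at hcard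
    have : M + 1 ≤ M := by exact_mod_cast hcard
    omega
  choose color hcolor using avoid
  let f : J → Fin (M + 1) := hwf.fix color
  have hf : ∀ i j, WellOrderingRel j i → A i j → f j ≠ f i := by
    intro i j h hA
    have hfi : f i = color i (fun j _ => f j) := hwf.fix_eq color i
    rw [hfi]
    exact hcolor i (fun j _ => f j) j h hA
  refine ⟨f, fun i j hA => ?_⟩
  rcases trichotomous_of (WellOrderingRel : J → J → Prop) i j with h | rfl | h
  · exact hf j i h (hsymm i j hA)
  · exact (hirr i hA).elim
  · exact (hf i j h hA).symm

/-- In a proper pseudometric space, the number of `δ`-separated points in a given ball is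
bounded. -/
theorem exists_encard_le_of_separated {E : Type*} [PseudoMetricSpace E] [ProperSpace E] (c : E)
    (T : ℝ) {δ : ℝ} (hδ : 0 < δ) :
    ∃ M : ℕ, ∀ {ι : Type} (y : ι → E) (S : Set ι), (∀ i ∈ S, y i ∈ ball c T) →
      (S.Pairwise fun i j => δ ≤ dist (y i) (y j)) → S.encard ≤ M := by
  obtain ⟨t, -, htfin, hcover⟩ := (isCompact_closedBall c T).finite_cover_balls (half_pos hδ)
  refine ⟨t.ncard, fun y S hball hsep => ?_⟩
  have hnear : ∀ i ∈ S, ∃ p ∈ t, dist (y i) p < δ / 2 := by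
    intro i hi
    simpa using hcover (ball_subset_closedBall (hball i hi))
  have : Nonempty E := ⟨c⟩
  choose! p hpt hp using hnear
  rw [htfin.cast_ncard_eq]
  refine Set.encard_le_encard_of_injOn (f := p) hpt fun i hi j hj hij => ?_
  by_contra hne
  have hj' := hp j hj
  rw [← hij] at hj'
  linarith [hsep hi hj hne, dist_triangle_right (y i) (y j) (p i), hp i hi]

/-- **Decomposition of a Vitali family of balls into boundedly many radius-separated
subfamilies** (Lemma 7.4). For each `n` and `R ≥ 5` there is `N = N(n,R)` such that any
countable collection of balls `{B_{r_i}(x_i)}_{i ∈ J}` contained in `B_2(0) ⊆ ℝⁿ`, with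
`{B_{r_i/5}(x_i)}` pairwise disjoint, can be partitioned into `N` subfamilies such that
within each subfamily, distinct indices `i ≠ j` with `x_j ∈ B_{R r_i}(x_i)` satisfy
`r_j < R⁻² r_i`. -/
theorem vitali_family_decomposition (n : ℕ) (R : ℝ) (hR : 5 ≤ R) :
    ∃ N : ℕ, 0 < N ∧
      ∀ (J : Type) [Countable J], ∀ (x : J → EuclideanSpace ℝ (Fin n)) (r : J → ℝ),
      (∀ i, 0 < r i) →
      (∀ i, ball (x i) (r i) ⊆ ball (0 : EuclideanSpace ℝ (Fin n)) 2) →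
      (Pairwise fun i j => Disjoint (ball (x i) (r i / 5)) (ball (x j) (r j / 5))) →
      ∃ f : J → Fin N, ∀ i j, i ≠ j → f i = f j →
        x j ∈ ball (x i) (R * r i) → r j < r i / R ^ 2 := by
  obtain ⟨M, hM⟩ := exists_encard_le_of_separated (0 : EuclideanSpace ℝ (Fin n)) (R ^ 3)
    (δ := 1 / (5 * R ^ 2)) (by positivity)
  refine ⟨M + 1, M.succ_pos, fun J _ x r hr _ hdisj => ?_⟩
  have hR0 : 0 < R := by linarith
  have hsep : ∀ i j, i ≠ j → r i / 5 ≤ dist (x i) (x j) := by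
    intro i j hij
    by_contra! hlt
    exact Set.disjoint_left.mp (hdisj hij) (mem_ball'.mpr hlt)
      (mem_ball_self (by linarith [hr j]))
  let C : J → J → Prop := fun i j => dist (x i) (x j) < R * r i ∧ r i ≤ R ^ 2 * r j
  let A : J → J → Prop := fun i j => i ≠ j ∧ (C i j ∨ C j i)
  have hA : ∀ i j, A i j → dist (x i) (x j) < R ^ 3 * r i ∧ r i ≤ R ^ 2 * r j := by
    rintro i j ⟨hij, ⟨hd, hle⟩ | ⟨hd, hle⟩⟩
    · refine ⟨hd.trans_le ?_, hle⟩
      have hR3 : R ≤ R ^ 3 := le_self_pow₀ (by linarith) (by norm_num)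
      exact mul_le_mul_of_nonneg_right hR3 (hr i).le
    · rw [dist_comm] at hd
      constructor
      · calc dist (x i) (x j) < R * r j := hd
          _ ≤ R * (R ^ 2 * r i) := by gcongr
          _ = R ^ 3 * r i := by ring
      · calc r i ≤ 5 * (R * r j) := by linarith [hsep i j hij]
          _ ≤ R * (R * r j) := by
            have := hr j
            gcongr
          _ = R ^ 2 * r j := by ring
  obtain ⟨f, hf⟩ := exists_coloring_of_encard_le A (fun i j h => ⟨h.1.symm, h.2.symm⟩)
    (fun i h => h.1 rfl) M fun i => by
      refine hM (fun j => (r i)⁻¹ • (x j - x i)) {j | A i j} (fun j hj => ?_)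
        fun j hj k _ hjk => ?_
      · rw [mem_ball_zero_iff, norm_smul, norm_inv, Real.norm_of_nonneg (hr i).le,
          ← dist_eq_norm, dist_comm, inv_mul_lt_iff₀ (hr i), mul_comm]
        exact (hA i j hj).1
      · beta_reduce
        rw [dist_smul₀, dist_sub_right, norm_inv, Real.norm_of_nonneg (hr i).le,
          le_inv_mul_iff₀ (hr i), mul_one_div, div_le_iff₀ (by positivity)]
        calc r i ≤ R ^ 2 * r j := (hA i j hj).2
          _ = r j / 5 * (5 * R ^ 2) := by ring
          _ ≤ dist (x j) (x k) * (5 * R ^ 2) := by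
            gcongr
            exact hsep j k hjk
  refine ⟨f, fun i j hij hfij hball => ?_⟩
  by_contra! hlt
  rw [div_le_iff₀' (by positivity)] at hlt
  exact hf i j ⟨hij, Or.inl ⟨mem_ball'.mp hball, hlt⟩⟩ hfij
end
end
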